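/- arXiv:2107.01488 — 8 statements merged into one kernel-verified Lean document; each statement's English description precedes it below -/
import Mathlib

section
/- For every natural number n ≥ 1 and every nonzero complex number z, the Boys function satisfies the forward recursion F(n,z) = ((n - 1/2)/z) · F(n-1,z) - e^{-z}/(2z). -/
open MeasureTheory

/-- The Boys function `F(n,z) = ∫₀¹ e^{-z t²} t^{2n} dt`. -/
noncomputable def boys (n : ℕ) (z : ℂ) : ℂ :=
  ∫ t in (0:ℝ)..1, Complex.exp (-z * (t:ℂ)^2) * (t:ℂ)^(2*n)

lemma intervalIntegrable_boys (n : ℕ) (z : ℂ) :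
    IntervalIntegrable (fun t : ℝ => Complex.exp (-z * (t:ℂ)^2) * (t:ℂ)^(2*n)) volume 0 1 :=
  (by fun_prop : Continuous fun t : ℝ =>
    Complex.exp (-z * (t:ℂ)^2) * (t:ℂ)^(2*n)).intervalIntegrable 0 1

lemma hasDerivAt_exp_mul_pow (m : ℕ) (z : ℂ) (t : ℝ) :
    HasDerivAt (fun t : ℝ => Complex.exp (-z * (t:ℂ)^2) * (t:ℂ)^(2*m+1))
      ((2*m+1) * (Complex.exp (-z * (t:ℂ)^2) * (t:ℂ)^(2*m)) -
        2*z * (Complex.exp (-z * (t:ℂ)^2) * (t:ℂ)^(2*(m+1)))) t := by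
  have h : HasDerivAt (fun w : ℂ => Complex.exp (-z * w^2) * w^(2*m+1)) _ (t:ℂ) :=
    (((hasDerivAt_pow 2 (t:ℂ)).const_mul (-z)).cexp).mul (hasDerivAt_pow (2*m+1) (t:ℂ))
  convert h.comp_ofReal using 1
  push_cast [Nat.add_sub_cancel]
  ring

/-- Integration by parts for the Boys function, in division-free form. -/
lemma boys_integration_by_parts (m : ℕ) (z : ℂ) :
    (2*m+1) * boys m z - 2*z * boys (m+1) z = Complex.exp (-z) := by
  have hm := (intervalIntegrable_boys m z).const_mul (2*m+1 : ℂ)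
  have hs := (intervalIntegrable_boys (m+1) z).const_mul (2*z)
  have h := intervalIntegral.integral_eq_sub_of_hasDerivAt
    (fun t _ => hasDerivAt_exp_mul_pow m z t) (hm.sub hs)
  rw [intervalIntegral.integral_sub hm hs, intervalIntegral.integral_const_mul,
    intervalIntegral.integral_const_mul] at h
  simpa [boys] using h

/-- Forward recursion for the Boys function:
`F(n,z) = ((n - 1/2)/z) F(n-1,z) - e^{-z}/(2z)` for `n ≥ 1` and `z ≠ 0`. -/
theorem boys_forward_recursion (n : ℕ) (hn : 1 ≤ n) (z : ℂ) (hz : z ≠ 0) :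
    boys n z = (((n:ℂ) - 1/2) / z) * boys (n - 1) z - Complex.exp (-z) / (2*z) := by
  obtain ⟨m, rfl⟩ := Nat.exists_eq_add_of_le' hn
  rw [← boys_integration_by_parts m z, Nat.add_sub_cancel]
  push_cast
  field_simp
  ring
end

section
/- For every complex number z with Re(z) ≥ 0, F(0,z) = (1/√π) ∫₀^∞ q(t² + z) dt, where q : ℂ → ℂ is defined by q(ξ) = (1 - e^{-ξ})/ξ for ξ ≠ 0 and q(0) = 1. -/
open MeasureTheory

/-- The analytic function `q(ξ) = (1 - e^{-ξ})/ξ`, with `q(0) = 1`. -/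
noncomputable def qfun (ξ : ℂ) : ℂ :=
  if ξ = 0 then 1 else (1 - Complex.exp (-ξ)) / ξ

open Complex in
/-- After the substitution `s = u ^ 2`, this is `q(ξ) = ∫₀¹ e^{-s ξ} ds`. -/
theorem qfun_eq_integral (ξ : ℂ) :
    qfun ξ = ∫ u in (0:ℝ)..1, 2 * (u:ℂ) * exp (-(u:ℂ) ^ 2 * ξ) := by
  unfold qfun
  split_ifs with h
  · subst h
    have hderiv : ∀ u ∈ Set.uIcc (0:ℝ) 1,
        HasDerivAt (fun u : ℝ => (u:ℂ) ^ 2) (2 * (u:ℂ) * exp (-(u:ℂ) ^ 2 * 0)) u := by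
      intro u _
      simpa using (hasDerivAt_id' u).ofReal_comp.fun_pow 2
    rw [intervalIntegral.integral_eq_sub_of_hasDerivAt hderiv
      (Continuous.intervalIntegrable (by fun_prop) _ _)]
    simp
  · have hderiv : ∀ u ∈ Set.uIcc (0:ℝ) 1,
        HasDerivAt (fun u : ℝ => -exp (-(u:ℂ) ^ 2 * ξ) / ξ)
          (2 * (u:ℂ) * exp (-(u:ℂ) ^ 2 * ξ)) u := by
      intro u _
      have hsq : HasDerivAt (fun u : ℝ => (u:ℂ) ^ 2) (2 * (u:ℂ)) u := by
        simpa using (hasDerivAt_id' u).ofReal_comp.fun_pow 2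
      refine ((hsq.fun_neg.mul_const ξ).cexp.fun_neg.div_const ξ).congr_deriv ?_
      field_simp
    rw [intervalIntegral.integral_eq_sub_of_hasDerivAt hderiv
      (Continuous.intervalIntegrable (by fun_prop) _ _)]
    simp only [ofReal_one, ofReal_zero]
    norm_num
    ring

open Complex in
theorem exp_neg_sq_mul_sq_add (z : ℂ) (u t : ℝ) :
    exp (-(u:ℂ) ^ 2 * ((t:ℂ) ^ 2 + z)) =
      exp (-(u:ℂ) ^ 2 * z) * (Real.exp (-u ^ 2 * t ^ 2) : ℝ) := by
  push_cast
  rw [← exp_add]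
  ring_nf

theorem two_mul_integral_exp_neg_sq_mul_sq {u : ℝ} (hu : 0 < u) :
    2 * u * ∫ t in Set.Ioi (0:ℝ), Real.exp (-u ^ 2 * t ^ 2) = Real.sqrt Real.pi := by
  rw [integral_gaussian_Ioi, Real.sqrt_div Real.pi_pos.le, Real.sqrt_sq hu.le]
  field_simp

open Complex in
theorem integrable_prod_two_mul_exp (z : ℂ) :
    Integrable (fun p : ℝ × ℝ => 2 * (p.1:ℂ) * exp (-(p.1:ℂ) ^ 2 * ((p.2:ℂ) ^ 2 + z)))
      ((volume.restrict (Set.Ioc (0:ℝ) 1)).prod (volume.restrict (Set.Ioi (0:ℝ)))) := by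
  rw [integrable_prod_iff (Continuous.aestronglyMeasurable (by fun_prop))]
  constructor
  · filter_upwards [ae_restrict_mem measurableSet_Ioc] with u hu
    simp only [exp_neg_sq_mul_sq_add, ← mul_assoc]
    exact ((integrable_exp_neg_mul_sq (pow_pos hu.1 2)).integrableOn.ofReal).const_mul _
  · have hint : IntegrableOn (fun u : ℝ => Real.sqrt Real.pi * ‖exp (-(u:ℂ) ^ 2 * z)‖)
        (Set.Ioc (0:ℝ) 1) :=
      (Continuous.integrableOn_Icc (by fun_prop)).mono_set Set.Ioc_subset_Icc_self
    refine hint.congr_fun (fun u hu => ?_) measurableSet_Ioc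
    simp only [exp_neg_sq_mul_sq_add, norm_mul, norm_real, Real.norm_eq_abs, Real.abs_exp,
      abs_of_pos hu.1, ← mul_assoc]
    rw [integral_const_mul, ← two_mul_integral_exp_neg_sq_mul_sq hu.1, norm_ofNat]
    ring

open Complex in
theorem integral_qfun_sq_add (z : ℂ) :
    ∫ t in Set.Ioi (0:ℝ), qfun ((t:ℂ) ^ 2 + z) = (Real.sqrt Real.pi : ℂ) * boys 0 z := by
  simp only [qfun_eq_integral, boys, intervalIntegral.integral_of_le zero_le_one]
  rw [← integral_integral_swap (integrable_prod_two_mul_exp z), ← integral_const_mul]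
  refine setIntegral_congr_fun measurableSet_Ioc fun u hu => ?_
  simp only [exp_neg_sq_mul_sq_add, ← mul_assoc]
  rw [integral_const_mul, integral_complex_ofReal, ← two_mul_integral_exp_neg_sq_mul_sq hu.1]
  push_cast
  ring_nf

/-- For `Re(z) ≥ 0`, `F(0,z) = (1/√π) ∫₀^∞ q(t² + z) dt`. -/
theorem boys_zero_eq_integral_qfun (z : ℂ) (hz : 0 ≤ z.re) :
    boys 0 z = (1 / (Real.sqrt Real.pi : ℂ)) * ∫ t in Set.Ioi (0:ℝ), qfun ((t:ℂ)^2 + z) := by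
  have hpi : (Real.sqrt Real.pi : ℂ) ≠ 0 :=
    Complex.ofReal_ne_zero.mpr (Real.sqrt_pos.mpr Real.pi_pos).ne'
  rw [integral_qfun_sq_add]
  field_simp
end

section
/- Let a > 0 be real and let z be a complex number with Re(z) ≥ 0 and |z| > a². Then |F(0,z) - ( √π/(2√z) - (e^{-z}/√π) ∑_{j=0}^∞ (-1)^j z^{-j-1} ∫₀^a e^{-t²} t^{2j} dt )| ≤ |e^{-z}|·(1/√π)·( e^{-a²}/a - √π · erfc(a) ). -/
open MeasureTheory

/-- The real error function `erf(y) = (2/√π) ∫₀^y e^{-t²} dt`. -/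
noncomputable def erf (y : ℝ) : ℝ :=
  (2 / Real.sqrt Real.pi) * ∫ t in (0:ℝ)..y, Real.exp (-t^2)

/-- The complementary error function `erfc(y) = 1 - erf(y)`. -/
noncomputable def erfc (y : ℝ) : ℝ := 1 - erf y

open Set Filter Topology

lemma sq_le_norm_add_sq {z : ℂ} (hre : 0 ≤ z.re) (s : ℝ) : s ^ 2 ≤ ‖z + (s : ℂ) ^ 2‖ := by
  have h := Complex.re_le_norm (z + (s : ℂ) ^ 2)
  have h' : (z + (s : ℂ) ^ 2).re = z.re + s ^ 2 := by
    rw [← Complex.ofReal_pow, Complex.add_re, Complex.ofReal_re]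
  linarith

lemma norm_le_norm_add_sq {z : ℂ} (hre : 0 ≤ z.re) (s : ℝ) : ‖z‖ ≤ ‖z + (s : ℂ) ^ 2‖ := by
  rw [← Complex.ofReal_pow, ← sq_le_sq₀ (norm_nonneg _) (norm_nonneg _), Complex.sq_norm,
    Complex.sq_norm, Complex.normSq_apply, Complex.normSq_apply]
  simp only [Complex.add_re, Complex.add_im, Complex.ofReal_re, Complex.ofReal_im, add_zero]
  nlinarith [sq_nonneg s, mul_nonneg hre (sq_nonneg s), sq_nonneg (s ^ 2)]

lemma add_sq_ne_zero {z : ℂ} (hre : 0 ≤ z.re) (hz : z ≠ 0) (s : ℝ) : z + (s : ℂ) ^ 2 ≠ 0 :=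
  norm_pos_iff.1 ((norm_pos_iff.2 hz).trans_le (norm_le_norm_add_sq hre s))

lemma continuous_inv_add_sq {z : ℂ} (hre : 0 ≤ z.re) (hz : z ≠ 0) :
    Continuous fun s : ℝ => (z + (s : ℂ) ^ 2)⁻¹ :=
  Continuous.inv₀ (by fun_prop) (add_sq_ne_zero hre hz)

lemma integrable_inv_add_sq {z : ℂ} (hre : 0 ≤ z.re) (hz : z ≠ 0) :
    Integrable fun s : ℝ => (z + (s : ℂ) ^ 2)⁻¹ := by
  have hz' : 0 < ‖z‖ := norm_pos_iff.2 hz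
  refine (integrable_inv_one_add_sq.const_mul (1 + ‖z‖⁻¹)).mono'
    (continuous_inv_add_sq hre hz).aestronglyMeasurable (.of_forall fun s => ?_)
  have h1 := sq_le_norm_add_sq hre s
  have h2 := norm_le_norm_add_sq hre s
  have h3 : 0 < ‖z + (s : ℂ) ^ 2‖ := hz'.trans_le h2
  rw [norm_inv, ← div_eq_mul_inv, inv_eq_one_div, div_le_div_iff₀ h3 (by positivity), one_mul,
    add_mul, one_mul]
  have h4 : 1 ≤ ‖z‖⁻¹ * ‖z + (s : ℂ) ^ 2‖ := by
    rw [← div_eq_inv_mul]; exact (one_le_div hz').2 h2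
  linarith

lemma integral_Ioi_inv_sq_add_sq {w : ℂ} (hw : 0 < w.re)
    (hinteg : IntegrableOn (fun s : ℝ => (w ^ 2 + (s : ℂ) ^ 2)⁻¹) (Ioi 0)) :
    ∫ s in Ioi (0 : ℝ), (w ^ 2 + (s : ℂ) ^ 2)⁻¹ = Real.pi / (2 * w) := by
  have hw0 : w ≠ 0 := by rintro rfl; simp at hw
  have hp (s : ℝ) : w + s * Complex.I ∈ Complex.slitPlane := Or.inl (by simpa using hw)
  have hm (s : ℝ) : w - s * Complex.I ∈ Complex.slitPlane := Or.inl (by simpa using hw)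
  have hderiv (s : ℝ) : HasDerivAt (fun s : ℝ => (Complex.log (w + s * Complex.I) -
      Complex.log (w - s * Complex.I)) / (2 * w * Complex.I)) ((w ^ 2 + (s : ℂ) ^ 2)⁻¹) s := by
    have hlin : HasDerivAt (fun s : ℝ => (s : ℂ) * Complex.I) Complex.I s := by
      simpa using (hasDerivAt_id s).ofReal_comp.mul_const Complex.I
    have h := (((hlin.const_add w).clog_real (hp s)).sub
      ((hlin.const_sub w).clog_real (hm s))).div_const (2 * w * Complex.I)
    refine h.congr_deriv ?_
    have h1 := Complex.slitPlane_ne_zero (hp s)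
    have h2 := Complex.slitPlane_ne_zero (hm s)
    have h3 : w ^ 2 + (s : ℂ) ^ 2 = (w + s * Complex.I) * (w - s * Complex.I) := by
      linear_combination (s : ℂ) ^ 2 * Complex.I_sq
    have h4 : 2 * w = (w + s * Complex.I) + (w - s * Complex.I) := by ring
    have h5 : (w + s * Complex.I) + (w - s * Complex.I) ≠ 0 := by
      rw [← h4]; exact mul_ne_zero two_ne_zero hw0
    rw [h3, h4]
    generalize w + s * Complex.I = p at h1 h5 ⊢
    generalize w - s * Complex.I = q at h2 h5 ⊢
    field_simp
    ring
  have hinv : Tendsto (fun s : ℝ => w * ((s⁻¹ : ℝ) : ℂ)) atTop (𝓝 0) := by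
    have h := (Complex.continuous_ofReal.tendsto 0).comp tendsto_inv_atTop_zero
    simpa using h.const_mul w
  have hlimp : Tendsto (fun s : ℝ => Complex.log (w * ((s⁻¹ : ℝ) : ℂ) + Complex.I)) atTop
      (𝓝 (Real.pi / 2 * Complex.I)) := by
    rw [← Complex.log_I]
    refine (Tendsto.clog (x := Complex.I) ?_ (Or.inr (by simp)))
    simpa using hinv.add_const Complex.I
  have hlimm : Tendsto (fun s : ℝ => Complex.log (w * ((s⁻¹ : ℝ) : ℂ) - Complex.I)) atTop
      (𝓝 (-(Real.pi / 2 * Complex.I))) := by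
    rw [show -(Real.pi / 2 * Complex.I) = Complex.log (-Complex.I) by
      rw [Complex.log_neg_I]; ring]
    refine (Tendsto.clog (x := -Complex.I) ?_ (Or.inr (by simp)))
    simpa using hinv.sub_const Complex.I
  have hlim : Tendsto (fun s : ℝ => (Complex.log (w + s * Complex.I) -
      Complex.log (w - s * Complex.I)) / (2 * w * Complex.I)) atTop
      (𝓝 ((Real.pi / 2 * Complex.I - -(Real.pi / 2 * Complex.I)) / (2 * w * Complex.I))) := by
    refine ((hlimp.sub hlimm).div_const _).congr' ?_
    filter_upwards [eventually_gt_atTop 0] with s hs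
    have hs' : (s : ℂ) ≠ 0 := by exact_mod_cast hs.ne'
    have e1 : w + s * Complex.I = s * (w * ((s⁻¹ : ℝ) : ℂ) + Complex.I) := by
      push_cast; field_simp
    have e2 : w - s * Complex.I = s * (w * ((s⁻¹ : ℝ) : ℂ) - Complex.I) := by
      push_cast; field_simp
    have n1 := Complex.slitPlane_ne_zero (hp s)
    have n2 := Complex.slitPlane_ne_zero (hm s)
    rw [e1] at n1 ⊢
    rw [e2] at n2 ⊢
    rw [Complex.log_ofReal_mul hs (right_ne_zero_of_mul n1),
      Complex.log_ofReal_mul hs (right_ne_zero_of_mul n2)]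
    ring
  rw [integral_Ioi_of_hasDerivAt_of_tendsto' (fun s _ => hderiv s) hinteg hlim]
  simp only [Complex.ofReal_zero, zero_mul, add_zero, sub_zero, sub_self, zero_div]
  field_simp
  ring

lemma integral_Ioi_mul_exp_neg_mul_sq {t : ℝ} (ht : 0 < t) :
    ∫ s in Ioi (0 : ℝ), 2 * t * Real.exp (-t ^ 2 * s ^ 2) = Real.sqrt Real.pi := by
  rw [integral_const_mul, integral_gaussian_Ioi, Real.sqrt_div Real.pi_pos.le,
    Real.sqrt_sq ht.le]
  field_simp

lemma integral_Ioc_mul_exp_neg_mul_sq {u : ℂ} (hu : u ≠ 0) :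
    ∫ t in Ioc (0 : ℝ) 1, 2 * (t : ℂ) * Complex.exp (-u * (t : ℂ) ^ 2) =
      (1 - Complex.exp (-u)) * u⁻¹ := by
  rw [← intervalIntegral.integral_of_le zero_le_one]
  have hderiv (t : ℝ) : HasDerivAt (fun t : ℝ => -(Complex.exp (-u * (t : ℂ) ^ 2) * u⁻¹))
      (2 * (t : ℂ) * Complex.exp (-u * (t : ℂ) ^ 2)) t := by
    have h : HasDerivAt (fun t : ℂ => -(Complex.exp (-u * t ^ 2) * u⁻¹))
        (2 * (t : ℂ) * Complex.exp (-u * (t : ℂ) ^ 2)) (t : ℂ) := by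
      refine ((((hasDerivAt_pow 2 (t : ℂ)).const_mul (-u)).cexp.mul_const u⁻¹).neg).congr_deriv ?_
      field_simp
      simp [mul_comm]
    exact h.comp_ofReal
  rw [intervalIntegral.integral_eq_sub_of_hasDerivAt (fun t _ => hderiv t)
    (Continuous.intervalIntegrable (by fun_prop) _ _)]
  simp
  ring

lemma integrable_prod_mul_exp (z : ℂ) :
    Integrable (Function.uncurry fun t s : ℝ =>
      2 * (t : ℂ) * Complex.exp (-(z + (s : ℂ) ^ 2) * (t : ℂ) ^ 2))
      ((volume.restrict (Ioc 0 1)).prod (volume.restrict (Ioi 0))) := by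
  have hnorm {t : ℝ} (ht : 0 < t) (s : ℝ) :
      ‖2 * (t : ℂ) * Complex.exp (-(z + (s : ℂ) ^ 2) * (t : ℂ) ^ 2)‖ =
        Real.exp (-z.re * t ^ 2) * (2 * t * Real.exp (-t ^ 2 * s ^ 2)) := by
    have : (-(z + (s : ℂ) ^ 2) * (t : ℂ) ^ 2).re = -z.re * t ^ 2 + -t ^ 2 * s ^ 2 := by
      rw [← Complex.ofReal_pow, ← Complex.ofReal_pow, Complex.re_mul_ofReal]
      simp only [Complex.neg_re, Complex.add_re, Complex.ofReal_re]
      ring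
    rw [norm_mul, norm_mul, Complex.norm_exp, this, Real.exp_add, Complex.norm_real,
      Real.norm_of_nonneg ht.le, Complex.norm_ofNat]
    ring
  rw [integrable_prod_iff (Continuous.aestronglyMeasurable (by fun_prop))]
  refine ⟨?_, ?_⟩
  · filter_upwards [ae_restrict_mem measurableSet_Ioc] with t ht
    refine Integrable.mono' (((integrable_exp_neg_mul_sq (pow_pos ht.1 2)).integrableOn.const_mul
      (2 * t)).const_mul (Real.exp (-z.re * t ^ 2))) (Continuous.aestronglyMeasurable
        (by simp only [Function.uncurry]; fun_prop)) (.of_forall fun s => (hnorm ht.1 s).le)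
  · refine IntegrableOn.congr_fun (f := fun t : ℝ => Real.exp (-z.re * t ^ 2) * Real.sqrt Real.pi)
      ?_ (fun t ht => ?_) measurableSet_Ioc
    · exact (Continuous.integrableOn_Icc (by fun_prop)).mono_set Ioc_subset_Icc_self
    · simp only [Function.uncurry_apply_pair, hnorm ht.1]
      rw [integral_const_mul, integral_Ioi_mul_exp_neg_mul_sq ht.1]

lemma sqrt_pi_mul_boys_zero {z : ℂ} (hre : 0 ≤ z.re) (hz : z ≠ 0) :
    (Real.sqrt Real.pi : ℂ) * boys 0 z =
      ∫ s in Ioi (0 : ℝ), (1 - Complex.exp (-(z + (s : ℂ) ^ 2))) * (z + (s : ℂ) ^ 2)⁻¹ := by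
  calc (Real.sqrt Real.pi : ℂ) * boys 0 z
      = ∫ t in Ioc (0 : ℝ) 1, ∫ s in Ioi (0 : ℝ),
          2 * (t : ℂ) * Complex.exp (-(z + (s : ℂ) ^ 2) * (t : ℂ) ^ 2) := by
        rw [boys, ← intervalIntegral.integral_const_mul,
          intervalIntegral.integral_of_le zero_le_one]
        refine setIntegral_congr_fun measurableSet_Ioc fun t ht => ?_
        have h (s : ℝ) : 2 * (t : ℂ) * Complex.exp (-(z + (s : ℂ) ^ 2) * (t : ℂ) ^ 2) =
            Complex.exp (-z * (t : ℂ) ^ 2) * ((2 * t * Real.exp (-t ^ 2 * s ^ 2) : ℝ) : ℂ) := by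
          rw [show -(z + (s : ℂ) ^ 2) * (t : ℂ) ^ 2 =
            -z * (t : ℂ) ^ 2 + -(t : ℂ) ^ 2 * (s : ℂ) ^ 2 by ring, Complex.exp_add]
          push_cast
          ring
        simp only [h]
        rw [integral_const_mul, integral_complex_ofReal, integral_Ioi_mul_exp_neg_mul_sq ht.1]
        simp [mul_comm]
    _ = ∫ s in Ioi (0 : ℝ), ∫ t in Ioc (0 : ℝ) 1,
          2 * (t : ℂ) * Complex.exp (-(z + (s : ℂ) ^ 2) * (t : ℂ) ^ 2) :=
        integral_integral_swap (integrable_prod_mul_exp z)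
    _ = _ := by
        simp only [integral_Ioc_mul_exp_neg_mul_sq (add_sq_ne_zero hre hz _)]

lemma integrable_exp_neg_sq_mul_inv {z : ℂ} (hre : 0 ≤ z.re) (hz : z ≠ 0) :
    Integrable fun s : ℝ => (Real.exp (-s ^ 2) : ℂ) * (z + (s : ℂ) ^ 2)⁻¹ := by
  refine (integrable_inv_add_sq hre hz).norm.mono' (Continuous.aestronglyMeasurable ?_)
    (.of_forall fun s => ?_)
  · exact Continuous.mul (by fun_prop) (continuous_inv_add_sq hre hz)
  · rw [norm_mul, Complex.norm_real, Real.norm_of_nonneg (Real.exp_nonneg _)]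
    exact mul_le_of_le_one_left (norm_nonneg _)
      (Real.exp_le_one_iff.2 (neg_nonpos.2 (sq_nonneg s)))

lemma re_cpow_half_pos {z : ℂ} (hre : 0 ≤ z.re) (hz : z ≠ 0) : 0 < (z ^ (1 / 2 : ℂ)).re := by
  rw [one_div, Complex.cpow_inv_two_re]
  have := norm_pos_iff.2 hz
  positivity

lemma boys_zero_eq {z : ℂ} (hre : 0 ≤ z.re) (hz : z ≠ 0) :
    boys 0 z = (Real.sqrt Real.pi : ℂ) / (2 * z ^ (1 / 2 : ℂ)) -
      Complex.exp (-z) / (Real.sqrt Real.pi : ℂ) *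
        ∫ s in Ioi (0 : ℝ), (Real.exp (-s ^ 2) : ℂ) * (z + (s : ℂ) ^ 2)⁻¹ := by
  have hw := re_cpow_half_pos hre hz
  have hw2 : (z ^ (1 / 2 : ℂ)) ^ 2 = z := by
    rw [one_div]; exact Complex.cpow_ofNat_inv_pow z 2
  have hpi : (Real.sqrt Real.pi : ℂ) ≠ 0 := by
    exact_mod_cast (Real.sqrt_pos.2 Real.pi_pos).ne'
  have hpi2 : (Real.sqrt Real.pi : ℂ) ^ 2 = Real.pi := by
    exact_mod_cast Real.sq_sqrt Real.pi_pos.le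
  have hw0 : z ^ (1 / 2 : ℂ) ≠ 0 := fun h => by
    rw [h] at hw
    simp at hw
  have hJ : ∫ s in Ioi (0 : ℝ), (z + (s : ℂ) ^ 2)⁻¹ = Real.pi / (2 * z ^ (1 / 2 : ℂ)) := by
    have h := integral_Ioi_inv_sq_add_sq hw
    rw [hw2] at h
    exact h (integrable_inv_add_sq hre hz).integrableOn
  have hsplit (s : ℝ) : (1 - Complex.exp (-(z + (s : ℂ) ^ 2))) * (z + (s : ℂ) ^ 2)⁻¹ =
      (z + (s : ℂ) ^ 2)⁻¹ -
        Complex.exp (-z) * ((Real.exp (-s ^ 2) : ℂ) * (z + (s : ℂ) ^ 2)⁻¹) := by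
    rw [neg_add, Complex.exp_add]
    push_cast
    ring
  have h := sqrt_pi_mul_boys_zero hre hz
  simp only [hsplit] at h
  rw [integral_sub (integrable_inv_add_sq hre hz).integrableOn
    ((integrable_exp_neg_sq_mul_inv hre hz).integrableOn.const_mul _), hJ,
    integral_const_mul] at h
  rw [← mul_right_inj' hpi, h, ← hpi2]
  field_simp

lemma tsum_eq_integral_exp_neg_sq_mul_inv {a : ℝ} (ha : 0 < a) {z : ℂ} (hz : a ^ 2 < ‖z‖) :
    ∑' j : ℕ, (-1) ^ j * z ^ (-(j : ℤ) - 1) *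
        ((∫ t in (0 : ℝ)..a, Real.exp (-t ^ 2) * t ^ (2 * j) : ℝ) : ℂ) =
      ∫ t in (0 : ℝ)..a, (Real.exp (-t ^ 2) : ℂ) * (z + (t : ℂ) ^ 2)⁻¹ := by
  have hz0 : 0 < ‖z‖ := (sq_nonneg a).trans_lt hz
  have hzne : z ≠ 0 := norm_pos_iff.1 hz0
  have hr : a ^ 2 / ‖z‖ < 1 := (div_lt_one hz0).2 hz
  have hterm (j : ℕ) (t : ℝ) : (-1) ^ j * z ^ (-(j : ℤ) - 1) *
      ((Real.exp (-t ^ 2) * t ^ (2 * j) : ℝ) : ℂ) =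
      (Real.exp (-t ^ 2) : ℂ) * z⁻¹ * (-(t : ℂ) ^ 2 / z) ^ j := by
    rw [sub_eq_add_neg, zpow_add₀ hzne, zpow_neg, zpow_neg_one, zpow_natCast, div_pow,
      neg_pow ((t : ℂ) ^ 2), ← pow_mul]
    push_cast
    field_simp
  have hratio {t : ℝ} (ht : t ∈ uIoc 0 a) : ‖-(t : ℂ) ^ 2 / z‖ ≤ a ^ 2 / ‖z‖ := by
    rw [uIoc_of_le ha.le] at ht
    rw [norm_div, norm_neg, norm_pow, Complex.norm_real, Real.norm_of_nonneg ht.1.le]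
    gcongr
    · exact ht.1.le
    · exact ht.2
  have hsum : Summable fun j : ℕ => ‖z‖⁻¹ * (a ^ 2 / ‖z‖) ^ j :=
    (summable_geometric_of_lt_one (by positivity) hr).mul_left _
  have h := intervalIntegral.hasSum_integral_of_dominated_convergence (a := 0) (b := a)
    (μ := volume)
    (F := fun (j : ℕ) (t : ℝ) => (-1) ^ j * z ^ (-(j : ℤ) - 1) *
      ((Real.exp (-t ^ 2) * t ^ (2 * j) : ℝ) : ℂ))
    (f := fun t : ℝ => (Real.exp (-t ^ 2) : ℂ) * (z + (t : ℂ) ^ 2)⁻¹)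
    (fun j _ => ‖z‖⁻¹ * (a ^ 2 / ‖z‖) ^ j)
    (fun j => Continuous.aestronglyMeasurable (by fun_prop))
    (fun j => .of_forall fun t ht => ?_) (.of_forall fun t _ => hsum)
    intervalIntegrable_const (.of_forall fun t ht => ?_)
  · rw [← h.tsum_eq]
    refine tsum_congr fun j => ?_
    rw [intervalIntegral.integral_const_mul, intervalIntegral.integral_ofReal]
  · rw [hterm, norm_mul, norm_mul, norm_pow, Complex.norm_real,
      Real.norm_of_nonneg (Real.exp_nonneg _), norm_inv]
    gcongr
    · exact mul_le_of_le_one_left (by positivity)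
        (Real.exp_le_one_iff.2 (neg_nonpos.2 (sq_nonneg t)))
    · exact hratio ht
  · simp only [hterm]
    have hlt := (hratio ht).trans_lt hr
    have hne : 1 - -(t : ℂ) ^ 2 / z ≠ 0 := fun h0 => by
      rw [← sub_eq_zero.1 h0, norm_one] at hlt
      exact lt_irrefl _ hlt
    have e : z + (t : ℂ) ^ 2 = z * (1 - -(t : ℂ) ^ 2 / z) := by field_simp; ring
    rw [e, mul_inv, ← mul_assoc]
    exact (hasSum_geometric_of_norm_lt_one hlt).mul_left _

lemma integral_Ioi_exp_neg_sq_div_sq {a : ℝ} (ha : 0 < a) :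
    IntegrableOn (fun t : ℝ => Real.exp (-t ^ 2) / t ^ 2) (Ioi a) ∧
    ∫ t in Ioi a, Real.exp (-t ^ 2) / t ^ 2 =
      Real.exp (-a ^ 2) / a - Real.sqrt Real.pi * erfc a := by
  have hcont : Continuous fun t : ℝ => Real.exp (-t ^ 2) := by fun_prop
  have hderiv : ∀ t ∈ Ici a, HasDerivAt
      (fun t : ℝ => -(Real.exp (-t ^ 2) / t) - 2 * ∫ u in (0 : ℝ)..t, Real.exp (-u ^ 2))
      (Real.exp (-t ^ 2) / t ^ 2) t := by
    intro t ht
    have ht0 : t ≠ 0 := (ha.trans_le ht).ne'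
    have h1 : HasDerivAt (fun t : ℝ => Real.exp (-t ^ 2)) (Real.exp (-t ^ 2) * -(2 * t)) t := by
      simpa using (hasDerivAt_pow 2 t).fun_neg.exp
    refine (((h1.div (hasDerivAt_id t) ht0).neg).sub
      ((hcont.integral_hasStrictDerivAt 0 t).hasDerivAt.const_mul 2)).congr_deriv ?_
    simp only [id]
    field_simp
    ring
  have hgauss : ∫ u in Ioi (0 : ℝ), Real.exp (-u ^ 2) = Real.sqrt Real.pi / 2 := by
    simpa using integral_gaussian_Ioi 1
  have hinteg : Integrable fun u : ℝ => Real.exp (-u ^ 2) := by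
    simpa using integrable_exp_neg_mul_sq one_pos
  have hlim1 : Tendsto (fun t : ℝ => Real.exp (-t ^ 2) / t) atTop (𝓝 0) := by
    refine squeeze_zero' ?_ ?_ tendsto_inv_atTop_zero
    · filter_upwards [eventually_gt_atTop 0] with t ht using by positivity
    · filter_upwards [eventually_gt_atTop 0] with t ht
      rw [inv_eq_one_div]
      gcongr
      exact Real.exp_le_one_iff.2 (neg_nonpos.2 (sq_nonneg t))
  have hlim := hlim1.neg.sub
    ((intervalIntegral_tendsto_integral_Ioi 0 hinteg.integrableOn tendsto_id).const_mul 2)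
  have hnonneg : ∀ t ∈ Ioi a, 0 ≤ Real.exp (-t ^ 2) / t ^ 2 := fun t _ => by positivity
  refine ⟨integrableOn_Ioi_deriv_of_nonneg' hderiv hnonneg hlim, ?_⟩
  rw [integral_Ioi_of_hasDerivAt_of_nonneg' hderiv hnonneg hlim, hgauss, erfc, erf]
  have hpi := (Real.sqrt_pos.2 Real.pi_pos).ne'
  field_simp
  ring

/-- For `a > 0` and `Re z ≥ 0`, `|z| > a²`, the truncated-series approximation of `F(0,z)`
has error controlled by the tail of `∫ e^{-t²}/t² dt`. -/
theorem boys_zero_series_error (a : ℝ) (ha : 0 < a) (z : ℂ)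
    (hre : 0 ≤ z.re) (hz : a^2 < ‖z‖) :
    ‖boys 0 z -
        ((Real.sqrt Real.pi : ℂ) / (2 * z ^ (1/2 : ℂ)) -
          (Complex.exp (-z) / (Real.sqrt Real.pi : ℂ)) *
            ∑' j : ℕ, (-1)^j * z ^ (-(j:ℤ) - 1) *
              ((∫ t in (0:ℝ)..a, Real.exp (-t^2) * t^(2*j) : ℝ) : ℂ))‖
      ≤ ‖Complex.exp (-z)‖ * (1 / Real.sqrt Real.pi) *
          (Real.exp (-a^2) / a - Real.sqrt Real.pi * erfc a) := by
  have hzne : z ≠ 0 := norm_pos_iff.1 ((sq_nonneg a).trans_lt hz)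
  have hinteg := integrable_exp_neg_sq_mul_inv hre hzne
  obtain ⟨htail, htail_eq⟩ := integral_Ioi_exp_neg_sq_div_sq ha
  rw [boys_zero_eq hre hzne, tsum_eq_integral_exp_neg_sq_mul_inv ha hz, sub_sub_sub_cancel_left,
    ← mul_sub, ← intervalIntegral.integral_interval_add_Ioi (a := 0) (b := a) hinteg.integrableOn
      hinteg.integrableOn, sub_add_cancel_left, norm_mul, norm_neg, norm_div, Complex.norm_real,
    Real.norm_of_nonneg (Real.sqrt_nonneg _), div_eq_mul_one_div, ← htail_eq]
  gcongr
  refine norm_integral_le_of_norm_le htail ?_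
  filter_upwards [ae_restrict_mem measurableSet_Ioi] with t ht
  have ht0 : 0 < t := ha.trans ht
  rw [norm_mul, norm_inv, Complex.norm_real, Real.norm_of_nonneg (Real.exp_nonneg _),
    div_eq_mul_inv]
  gcongr
  exact sq_le_norm_add_sq hre t
end

section
/- For every complex number z, the series ∑_{j=0}^∞ (-1)^j z^j / (j! · (2j+1)) converges and F(0,z) = ∑_{j=0}^∞ (-1)^j z^j / (j! · (2j+1)). -/
open MeasureTheory

/-- Taylor series: for every complex `z`, `F(0,z) = ∑_{j=0}^∞ (-1)^j z^j/(j! (2j+1))`. -/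
theorem boys_zero_taylor (z : ℂ) :
    HasSum (fun j : ℕ => (-1)^j * z^j / ((j.factorial : ℂ) * (2*(j:ℂ)+1))) (boys 0 z) := by
  have key := intervalIntegral.hasSum_integral_of_dominated_convergence
    (μ := volume) (a := 0) (b := 1)
    (F := fun (j : ℕ) (t : ℝ) => ((-1) ^ j * z ^ j / (j.factorial : ℂ)) * (t : ℂ) ^ (2 * j))
    (f := fun t : ℝ => Complex.exp (-z * (t : ℂ) ^ 2) * (t : ℂ) ^ (2 * 0))
    (fun j _ => ‖z‖ ^ j / (j.factorial : ℝ))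
    (fun j => Continuous.aestronglyMeasurable (by fun_prop))
    (fun j => .of_forall fun t ht => ?_)
    (.of_forall fun t _ => Real.summable_pow_div_factorial ‖z‖)
    intervalIntegrable_const
    (.of_forall fun t _ => ?_)
  · unfold boys
    refine key.congr_fun fun j => ?_
    have hint : ∫ t in (0:ℝ)..1, (t : ℂ) ^ (2 * j) = 1 / (2 * (j : ℂ) + 1) := by
      have h : ∫ t in (0:ℝ)..1, t ^ (2 * j) = 1 / (2 * (j : ℝ) + 1) := by
        simp [integral_pow]
      simp_rw [← Complex.ofReal_pow, intervalIntegral.integral_ofReal, h]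
      push_cast
      rfl
    rw [intervalIntegral.integral_const_mul, hint, div_mul_div_comm, mul_one]
  · rw [Set.uIoc_of_le zero_le_one] at ht
    have h : |t| ^ (2 * j) ≤ 1 :=
      pow_le_one₀ (abs_nonneg t) (abs_le.mpr ⟨by linarith [ht.1], ht.2⟩)
    simpa using mul_le_of_le_one_right (by positivity : 0 ≤ ‖z‖ ^ j / (j.factorial : ℝ)) h
  · have h := NormedSpace.expSeries_div_hasSum_exp (-z * (t : ℂ) ^ 2)
    rw [← Complex.exp_eq_exp_ℂ] at h
    simp only [mul_zero, pow_zero, mul_one]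
    refine h.congr_fun fun j => ?_
    rw [mul_pow, neg_pow z, pow_mul]
    ring
end

section
/- For every complex number z with Re(z) ≥ 0, |q(2z)| ≤ |q(z)|, where q : ℂ → ℂ is defined by q(ξ) = (1 - e^{-ξ})/ξ for ξ ≠ 0 and q(0) = 1. -/
theorem qfun_two_mul (z : ℂ) : qfun (2 * z) = qfun z * ((1 + Complex.exp (-z)) / 2) := by
  by_cases h : z = 0
  · simp [qfun, h]
  · have h_exp : Complex.exp (-(2 * z)) = Complex.exp (-z) ^ 2 := by
      rw [← Complex.exp_nat_mul]
      push_cast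
      ring_nf
    simp only [qfun, mul_eq_zero, OfNat.ofNat_ne_zero, h, or_self, if_false, h_exp]
    field_simp
    ring

/-- For `Re z ≥ 0`, `|q(2z)| ≤ |q(z)|`. -/
theorem abs_qfun_two_mul_le (z : ℂ) (hz : 0 ≤ z.re) :
    ‖qfun (2*z)‖ ≤ ‖qfun z‖ := by
  rw [qfun_two_mul, norm_mul]
  refine mul_le_of_le_one_right (norm_nonneg _) ?_
  have h_exp : ‖Complex.exp (-z)‖ ≤ 1 := by
    simpa [Complex.norm_exp] using hz
  have h_add := norm_add_le 1 (Complex.exp (-z))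
  rw [norm_one] at h_add
  rw [norm_div, Complex.norm_ofNat]
  linarith
end

section
/- For every complex number z with Re(z) ≥ 0, |q(z)| ≤ 1, where q : ℂ → ℂ is defined by q(ξ) = (1 - e^{-ξ})/ξ for ξ ≠ 0 and q(0) = 1; that is, |q| attains its maximum value 1 on the closed right half-plane at z = 0. -/
/-- The map `z ↦ exp (-z)` is nonexpansive at `0` on the closed right half-plane. -/
theorem norm_one_sub_exp_neg_le {z : ℂ} (hz : 0 ≤ z.re) :
    ‖1 - Complex.exp (-z)‖ ≤ ‖z‖ := by
  have h := (convex_halfSpace_re_ge 0).norm_image_sub_le_of_norm_hasDerivWithin_le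
    (f := fun w : ℂ => Complex.exp (-w)) (f' := fun w => Complex.exp (-w) * -1) (C := 1)
    (x := z) (y := 0)
    (fun w _ => (hasDerivAt_neg w).cexp.hasDerivWithinAt)
    (fun w hw => by simpa [Complex.norm_exp] using hw) hz (by simp)
  simpa using h

/-- On the closed right half-plane, `|q(z)| ≤ 1`; since `q(0) = 1`, the maximum value `1`
is attained at `z = 0`. -/
theorem abs_qfun_le_one (z : ℂ) (hz : 0 ≤ z.re) :
    ‖qfun z‖ ≤ 1 ∧ qfun 0 = 1 := by
  refine ⟨?_, if_pos rfl⟩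
  unfold qfun
  split_ifs
  · simp
  · rw [norm_div]
    exact div_le_one_of_le₀ (norm_one_sub_exp_neg_le hz) (norm_nonneg z)
end

section
/- Let n ≥ 1 be a natural number, M a positive integer, ε ≥ 0, and let w₁,…,w_M and η₁,…,η_M be complex numbers such that |(1-s)^{n-1/2} - ∑_{m=1}^M w_m e^{η_m s}| ≤ ε for all s ∈ [0,1]. Then for every complex number z with Re(z) ≤ 0, |e^{z} F(n,z) - (1/2) ∑_{m=1}^M w_m p(z + η_m)| ≤ (ε/2)·ρ(Re z) ≤ ε/2, where p : ℂ → ℂ is defined by p(ξ) = (e^{ξ} - 1)/ξ for ξ ≠ 0 and p(0) = 1, and ρ : ℝ → ℝ is defined by ρ(x) = (e^{x} - 1)/x for x ≠ 0 and ρ(0) = 1. -/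
open MeasureTheory

/-- The analytic function `p(ξ) = (e^{ξ} - 1)/ξ`, with `p(0) = 1`. -/
noncomputable def pfun (ξ : ℂ) : ℂ :=
  if ξ = 0 then 1 else (Complex.exp ξ - 1) / ξ

/-- The real analogue `ρ(x) = (e^{x} - 1)/x`, with `ρ(0) = 1`. -/
noncomputable def rhofun (x : ℝ) : ℝ :=
  if x = 0 then 1 else (Real.exp x - 1) / x

theorem integral_exp_mul_eq_pfun (ξ : ℂ) :
    ∫ s in (0:ℝ)..1, Complex.exp (ξ * s) = pfun ξ := by
  unfold pfun
  split_ifs with h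
  · simp [h]
  · simp [integral_exp_mul_complex h]

theorem integral_exp_mul_eq_rhofun (x : ℝ) :
    ∫ s in (0:ℝ)..1, Real.exp (x * s) = rhofun x := by
  unfold rhofun
  split_ifs with h
  · simp [h]
  · simp [intervalIntegral.integral_comp_mul_left Real.exp h, div_eq_inv_mul]

theorem rhofun_le_one {x : ℝ} (hx : x ≤ 0) : rhofun x ≤ 1 := by
  unfold rhofun
  split_ifs with h
  · exact le_rfl
  · rw [div_le_one_of_neg (lt_of_le_of_ne hx h)]
    linarith [Real.add_one_le_exp x]

theorem continuous_one_sub_rpow {n : ℕ} (hn : 1 ≤ n) :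
    Continuous fun s : ℝ => (1 - s) ^ ((n:ℝ) - 1/2) := by
  have hn' : (1:ℝ) ≤ n := by exact_mod_cast hn
  exact (continuous_const.sub continuous_id).rpow_const fun _ => Or.inr (by linarith)

theorem mul_sq_rpow_sub_half {n : ℕ} (hn : 1 ≤ n) {t : ℝ} (ht : 0 ≤ t) :
    t * (t ^ 2) ^ ((n:ℝ) - 1/2) = t ^ (2 * n) := by
  obtain ⟨k, rfl⟩ := Nat.exists_eq_add_of_le' hn
  have : (t ^ 2) ^ (((k + 1 : ℕ) : ℝ) - 1/2) = t ^ (2 * k + 1) := by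
    rw [← Real.rpow_natCast t 2, ← Real.rpow_mul ht, ← Real.rpow_natCast]
    congr 1
    push_cast
    ring
  rw [this]
  ring

/-- The substitution `s = 1 - t²` in the scaled Boys function. -/
theorem exp_mul_boys {n : ℕ} (hn : 1 ≤ n) (z : ℂ) :
    Complex.exp z * boys n z =
      (1/2) * ∫ s in (0:ℝ)..1, Complex.exp (z * s) * (((1 - s) ^ ((n:ℝ) - 1/2) : ℝ) : ℂ) := by
  have hsub := intervalIntegral.integral_deriv_smul_comp (a := 0) (b := 1)
    (f := fun t : ℝ => 1 - t ^ 2) (f' := fun t => -(2 * t))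
    (g := fun s : ℝ => Complex.exp (z * s) * (((1 - s) ^ ((n:ℝ) - 1/2) : ℝ) : ℂ))
    (fun t _ => by simpa using (hasDerivAt_pow 2 t).const_sub 1)
    (by fun_prop)
    (by
      have := continuous_one_sub_rpow hn
      fun_prop)
  norm_num only at hsub
  rw [intervalIntegral.integral_symm 0 1] at hsub
  have hcongr : Complex.exp z * boys n z = -(1/2) * ∫ t in (0:ℝ)..1, -(2 * t) •
      ((fun s : ℝ => Complex.exp (z * s) * (((1 - s) ^ ((n:ℝ) - 1/2) : ℝ) : ℂ)) ∘
        fun t : ℝ => 1 - t ^ 2) t := by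
    rw [boys, ← intervalIntegral.integral_const_mul, ← intervalIntegral.integral_const_mul]
    refine intervalIntegral.integral_congr fun t ht => ?_
    rw [Set.uIcc_of_le zero_le_one] at ht
    have hexp : Complex.exp (z * ((1 - t ^ 2 : ℝ) : ℂ)) =
        Complex.exp z * Complex.exp (-z * (t:ℂ) ^ 2) := by
      rw [← Complex.exp_add]
      congr 1
      push_cast
      ring
    have hpow : (t:ℂ) ^ (2 * n) = t * (((t ^ 2) ^ ((n:ℝ) - 1/2) : ℝ) : ℂ) := by
      exact_mod_cast (mul_sq_rpow_sub_half hn ht.1).symm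
    simp only [Function.comp, Complex.real_smul, hexp, hpow, sub_sub_cancel]
    push_cast
    ring
  rw [hcongr]
  norm_num only at hsub ⊢
  rw [hsub]
  ring

/-- If `(1-s)^{n-1/2}` is approximated by `∑ w_m e^{η_m s}` uniformly on `[0,1]` with error `ε`,
then for `Re z ≤ 0`,
`|e^z F(n,z) - (1/2) ∑ w_m p(z + η_m)| ≤ (ε/2) ρ(Re z) ≤ ε/2`. -/
theorem scaled_boys_exponential_approximation (n : ℕ) (hn : 1 ≤ n) (M : ℕ) (hM : 0 < M)
    (ε : ℝ) (hε : 0 ≤ ε) (w η : Fin M → ℂ)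
    (happrox : ∀ s ∈ Set.Icc (0:ℝ) 1,
      ‖((((1 - s) ^ ((n:ℝ) - 1/2) : ℝ)) : ℂ) - ∑ m, w m * Complex.exp (η m * s)‖ ≤ ε)
    (z : ℂ) (hz : z.re ≤ 0) :
    ‖Complex.exp z * boys n z - (1/2) * ∑ m, w m * pfun (z + η m)‖
        ≤ (ε/2) * rhofun z.re
    ∧ (ε/2) * rhofun z.re ≤ ε/2 := by
  have hc := continuous_one_sub_rpow hn
  constructor
  · have hsum : ∑ m, w m * pfun (z + η m) =
        ∫ s in (0:ℝ)..1, Complex.exp (z * s) * ∑ m, w m * Complex.exp (η m * s) := by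
      simp_rw [Finset.mul_sum, ← integral_exp_mul_eq_pfun,
        ← intervalIntegral.integral_const_mul]
      rw [← intervalIntegral.integral_finsetSum
        fun m _ => (by fun_prop : Continuous _).intervalIntegrable _ _]
      congr! 3 with s m
      rw [add_mul, Complex.exp_add]
      ring
    rw [exp_mul_boys hn, hsum, ← mul_sub, ← intervalIntegral.integral_sub
      ((by fun_prop : Continuous _).intervalIntegrable _ _)
      ((by fun_prop : Continuous _).intervalIntegrable _ _), norm_mul]
    have hbound : ‖∫ s in (0:ℝ)..1,
        (Complex.exp (z * s) * (((1 - s) ^ ((n:ℝ) - 1/2) : ℝ) : ℂ) -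
          Complex.exp (z * s) * ∑ m, w m * Complex.exp (η m * s))‖ ≤
        ∫ s in (0:ℝ)..1, ε * Real.exp (z.re * s) := by
      refine intervalIntegral.norm_integral_le_of_norm_le zero_le_one
        (Filter.Eventually.of_forall fun s hs => ?_)
        ((by fun_prop : Continuous _).intervalIntegrable _ _)
      rw [← mul_sub, norm_mul, Complex.norm_exp, Complex.re_mul_ofReal, mul_comm]
      gcongr
      exact happrox s (Set.Ioc_subset_Icc_self hs)
    rw [intervalIntegral.integral_const_mul, integral_exp_mul_eq_rhofun] at hbound
    norm_num at hbound ⊢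
    linarith
  · exact mul_le_of_le_one_right (by positivity) (rhofun_le_one hz)
end

section
/- Let M be a positive integer, ε ≥ 0, and let w₁,…,w_M > 0 and η₁,…,η_M > 0 be real numbers such that |s^{-1/2} - ∑_{m=1}^M w_m e^{-η_m s}| ≤ ε · s^{-1/2} for all s ∈ (0,1]. Then for every complex number z with Re(z) ≥ 0, |F(0,z) - (1/2) ∑_{m=1}^M w_m (1 - e^{-(z + η_m)})/(z + η_m)| ≤ ε · F(0, Re z) ≤ ε. -/
open MeasureTheory

theorem integral_mul_exp_neg_mul_sq {a : ℂ} (ha : a ≠ 0) :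
    ∫ t in (0:ℝ)..1, (t : ℂ) * Complex.exp (-a * (t : ℂ) ^ 2)
      = (1 - Complex.exp (-a)) / (2 * a) := by
  have hderiv : ∀ t ∈ Set.uIcc (0:ℝ) 1,
      HasDerivAt (fun t : ℝ => -Complex.exp (-a * (t : ℂ) ^ 2) / (2 * a))
        ((t : ℂ) * Complex.exp (-a * (t : ℂ) ^ 2)) t := by
    intro t _
    have h := ((((((hasDerivAt_id (t : ℂ)).pow 2).const_mul (-a)).cexp).neg).div_const
      (2 * a)).comp_ofReal
    refine h.congr_deriv ?_
    simp only [id, Pi.pow_apply]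
    field_simp
    norm_num [mul_comm]
  rw [intervalIntegral.integral_eq_sub_of_hasDerivAt hderiv
    (Continuous.intervalIntegrable (by fun_prop) _ _)]
  simp only [Complex.ofReal_one, Complex.ofReal_zero]
  norm_num
  ring

theorem abs_one_sub_mul_le_of_abs_rpow_neg_half_sub_le {t S ε : ℝ} (ht : 0 < t)
    (h : |(t ^ 2) ^ (-(1/2) : ℝ) - S| ≤ ε * (t ^ 2) ^ (-(1/2) : ℝ)) :
    |1 - t * S| ≤ ε := by
  have hs : (t ^ 2) ^ (-(1/2) : ℝ) = t⁻¹ := by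
    rw [← Real.rpow_natCast, ← Real.rpow_mul ht.le, ← Real.rpow_neg_one]
    norm_num
  rw [hs] at h
  calc |1 - t * S| = t * |t⁻¹ - S| := by
        rw [← abs_of_pos ht, ← abs_mul, abs_of_pos ht, mul_sub, mul_inv_cancel₀ ht.ne']
    _ ≤ t * (ε * t⁻¹) := by gcongr
    _ = ε := by field_simp

/-- If `s^{-1/2}` is approximated on `(0,1]` by `∑ w_m e^{-η_m s}` with relative error `ε`,
then for `Re z ≥ 0`,
`|F(0,z) - (1/2) ∑ w_m (1 - e^{-(z+η_m)})/(z+η_m)| ≤ ε F(0, Re z) ≤ ε`. -/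
theorem boys_zero_quadrature_error (M : ℕ) (hM : 0 < M) (ε : ℝ) (hε : 0 ≤ ε)
    (w η : Fin M → ℝ) (hw : ∀ m, 0 < w m) (hη : ∀ m, 0 < η m)
    (happrox : ∀ s ∈ Set.Ioc (0:ℝ) 1,
      |s ^ (-(1/2) : ℝ) - ∑ m, w m * Real.exp (-(η m) * s)| ≤ ε * s ^ (-(1/2) : ℝ))
    (z : ℂ) (hz : 0 ≤ z.re) :
    ‖boys 0 z - (1/2) * ∑ m, (w m : ℂ) *
        (1 - Complex.exp (-(z + (η m : ℂ)))) / (z + (η m : ℂ))‖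
      ≤ ε * ∫ t in (0:ℝ)..1, Real.exp (-z.re * t^2)
    ∧ ε * (∫ t in (0:ℝ)..1, Real.exp (-z.re * t^2)) ≤ ε := by
  have hne (m : Fin M) : z + (η m : ℂ) ≠ 0 := by
    intro h
    have := congrArg Complex.re h
    simp only [Complex.add_re, Complex.ofReal_re, Complex.zero_re] at this
    linarith [hη m]
  constructor
  · have hquad : (1/2) * ∑ m, (w m : ℂ) *
        (1 - Complex.exp (-(z + (η m : ℂ)))) / (z + (η m : ℂ))
        = ∫ t in (0:ℝ)..1, ∑ m, (w m : ℂ) *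
          ((t : ℂ) * Complex.exp (-(z + (η m : ℂ)) * (t : ℂ) ^ 2)) := by
      rw [intervalIntegral.integral_finsetSum
        (fun m _ => Continuous.intervalIntegrable (by fun_prop) _ _), Finset.mul_sum]
      refine Finset.sum_congr rfl fun m _ => ?_
      rw [intervalIntegral.integral_const_mul, integral_mul_exp_neg_mul_sq (hne m)]
      have := hne m
      field_simp
    rw [boys, hquad, ← intervalIntegral.integral_sub
      (Continuous.intervalIntegrable (by fun_prop) _ _)
      (Continuous.intervalIntegrable (by fun_prop) _ _),
      ← intervalIntegral.integral_const_mul]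
    refine intervalIntegral.norm_integral_le_of_norm_le zero_le_one
      (Filter.Eventually.of_forall fun t ht => ?_)
      (Continuous.intervalIntegrable (by fun_prop) _ _)
    have hfactor : Complex.exp (-z * (t : ℂ) ^ 2) * (t : ℂ) ^ (2 * 0) -
        ∑ m, (w m : ℂ) * ((t : ℂ) * Complex.exp (-(z + (η m : ℂ)) * (t : ℂ) ^ 2))
        = Complex.exp (-z * (t : ℂ) ^ 2) *
          ((1 - t * ∑ m, w m * Real.exp (-(η m) * t ^ 2) : ℝ) : ℂ) := by
      push_cast
      rw [mul_sub, Finset.mul_sum, Finset.mul_sum, pow_zero]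
      congr 1
      refine Finset.sum_congr rfl fun m _ => ?_
      rw [neg_add, add_mul, Complex.exp_add]
      ring
    have hre : (-z * (t : ℂ) ^ 2).re = -z.re * t ^ 2 := by
      rw [← Complex.ofReal_pow, Complex.re_mul_ofReal, Complex.neg_re]
    rw [hfactor, norm_mul, Complex.norm_exp, hre, Complex.norm_real, Real.norm_eq_abs,
      mul_comm]
    gcongr
    exact abs_one_sub_mul_le_of_abs_rpow_neg_half_sub_le ht.1
      (happrox _ ⟨pow_pos ht.1 2, pow_le_one₀ ht.1.le ht.2⟩)
  · refine mul_le_of_le_one_right hε ?_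
    calc ∫ t in (0:ℝ)..1, Real.exp (-z.re * t ^ 2) ≤ ∫ _ in (0:ℝ)..1, (1 : ℝ) := by
          refine intervalIntegral.integral_mono_on zero_le_one
            (Continuous.intervalIntegrable (by fun_prop) _ _)
            (Continuous.intervalIntegrable (by fun_prop) _ _) fun t _ => ?_
          rw [Real.exp_le_one_iff]
          nlinarith [mul_nonneg hz (sq_nonneg t)]
      _ = 1 := by simp
end
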